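/- Let R be an integral domain with 2 invertible, and let d, D ∈ R. Then R[x]/(x² − d) ≅ R[y]/(y² − D) as R-algebras if and only if d and D lie in the same class of R modulo squares of units, i.e. d = a²D for some a ∈ R^×. -/

import Mathlib

open Polynomial

namespace AdjoinRoot

variable {R : Type*} [CommRing R]

theorem root_X_sq_sub_C_sq (d : R) :
    root (X ^ 2 - C d) ^ 2 = algebraMap R (AdjoinRoot (X ^ 2 - C d)) d := by
  have h := eval₂_root (X ^ 2 - C d)
  simpa [sub_eq_zero] using h

theorem exists_eq_algebraMap_add_mul_root [Nontrivial R] (d : R)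
    (x : AdjoinRoot (X ^ 2 - C d)) :
    ∃ p q : R, x = algebraMap R (AdjoinRoot (X ^ 2 - C d)) p +
      algebraMap R (AdjoinRoot (X ^ 2 - C d)) q * root (X ^ 2 - C d) := by
  have hm : (X ^ 2 - C d).Monic := monic_X_pow_sub_C d two_ne_zero
  obtain ⟨f, rfl⟩ := mk_surjective x
  have hdeg : (f %ₘ (X ^ 2 - C d)).natDegree ≤ 1 := by
    have h := natDegree_modByMonic_lt f hm (fun h => by
      have := congrArg natDegree h
      simp at this)
    rw [natDegree_X_pow_sub_C] at h
    lia
  obtain ⟨q, p, h⟩ := exists_eq_X_add_C_of_natDegree_le_one hdeg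
  refine ⟨p, q, ?_⟩
  rw [← mk_leftInverse hm (mk _ f), modByMonicHom_mk, h]
  simp [add_comm]

theorem eq_zero_of_algebraMap_add_mul_root_eq_zero [Nontrivial R] {d p q : R}
    (h : algebraMap R (AdjoinRoot (X ^ 2 - C d)) p +
      algebraMap R (AdjoinRoot (X ^ 2 - C d)) q * root (X ^ 2 - C d) = 0) :
    p = 0 ∧ q = 0 := by
  have hm : (X ^ 2 - C d).Monic := monic_X_pow_sub_C d two_ne_zero
  have h0 : C q * X + C p = 0 := by
    by_contra hne
    refine mk_ne_zero_of_natDegree_lt hm hne ?_ ?_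
    · rw [natDegree_X_pow_sub_C]
      exact natDegree_linear_le.trans_lt one_lt_two
    · simpa [add_comm] using h
  exact ⟨by simpa using congrArg (coeff · 0) h0, by simpa using congrArg (coeff · 1) h0⟩

/-- The homomorphism `R[x]/(x² - d) → R[y]/(y² - D)` sending `x` to `a * y`, for `d = a² * D`. -/
noncomputable def scaleRoot (a d D : R) (h : d = a ^ 2 * D) :
    AdjoinRoot (X ^ 2 - C d) →ₐ[R] AdjoinRoot (X ^ 2 - C D) :=
  liftAlgHom _ (Algebra.ofId R _) (algebraMap R _ a * root (X ^ 2 - C D)) <| by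
    subst h
    simp [mul_pow, root_X_sq_sub_C_sq, -map_mul, -map_pow]
    simp

theorem scaleRoot_root (a d D : R) (h : d = a ^ 2 * D) :
    scaleRoot a d D h (root _) = algebraMap R _ a * root (X ^ 2 - C D) :=
  liftAlgHom_root ..

theorem scaleRoot_comp_scaleRoot {a b d D : R} (hab : a * b = 1) (h : d = a ^ 2 * D)
    (h' : D = b ^ 2 * d) :
    (scaleRoot b D d h').comp (scaleRoot a d D h) = AlgHom.id R _ := by
  apply algHom_ext
  rw [AlgHom.comp_apply, scaleRoot_root, map_mul, AlgHom.commutes, scaleRoot_root, ← mul_assoc,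
    ← map_mul, hab, map_one, one_mul, AlgHom.id_apply]

end AdjoinRoot

open AdjoinRoot in
/-- For a domain R with 2 invertible, R[x]/(x² - d) ≅ R[y]/(y² - D) as R-algebras
iff d = a²·D for some unit a. -/
theorem quadratic_algebra_iso_iff_disc_class
    (R : Type*) [CommRing R] [IsDomain R] (h2 : IsUnit (2 : R)) (d D : R) :
    Nonempty (AdjoinRoot (X ^ 2 - C d) ≃ₐ[R] AdjoinRoot (X ^ 2 - C D)) ↔
      ∃ a : Rˣ, d = (a : R) ^ 2 * D := by
  constructor
  · rintro ⟨φ⟩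
    obtain ⟨p, q, hφ⟩ := exists_eq_algebraMap_add_mul_root D (φ (root _))
    obtain ⟨p', q', hψ⟩ := exists_eq_algebraMap_add_mul_root d (φ.symm (root _))
    have hqq : q * q' - 1 = 0 := by
      have h := congrArg φ.symm hφ
      rw [φ.symm_apply_apply, map_add, map_mul, AlgEquiv.commutes, AlgEquiv.commutes, hψ] at h
      refine (eq_zero_of_algebraMap_add_mul_root_eq_zero (d := d) (p := p + q * p') ?_).2
      simp only [map_add, map_sub, map_mul, map_one]
      linear_combination -h
    have hsq : p ^ 2 + q ^ 2 * D - d = 0 ∧ 2 * p * q = 0 := by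
      have h := congrArg φ (root_X_sq_sub_C_sq d)
      rw [map_pow, hφ, AlgEquiv.commutes] at h
      apply eq_zero_of_algebraMap_add_mul_root_eq_zero (d := D)
      simp only [map_add, map_sub, map_mul, map_pow, map_ofNat]
      linear_combination h - algebraMap R (AdjoinRoot (X ^ 2 - C D)) q ^ 2 * root_X_sq_sub_C_sq D
    have hp : p = 0 := by
      refine (h2.mul_right_eq_zero).1 ?_
      linear_combination q' * hsq.2 - 2 * p * hqq
    refine ⟨⟨q, q', by linear_combination hqq, by linear_combination hqq⟩, ?_⟩
    simp only
    linear_combination p * hp - hsq.1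
  · rintro ⟨a, h⟩
    have h' : D = (↑a⁻¹ : R) ^ 2 * d := by
      rw [h, ← mul_assoc, ← mul_pow, Units.inv_mul, one_pow, one_mul]
    exact ⟨AlgEquiv.ofAlgHom (scaleRoot _ d D h) (scaleRoot _ D d h')
      (scaleRoot_comp_scaleRoot a.inv_mul h' h) (scaleRoot_comp_scaleRoot a.mul_inv h h')⟩
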